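/- For the Schrödinger operator H_{k,α} = L_k + α δ_0 on the path graph {-k,...,k} with α ≥ 0, the second-lowest eigenvalue λ_1(V_k, αδ_0) equals the lowest eigenvalue λ_0(V_k, ∞δ_0) of the Laplacian with a Dirichlet condition at the vertex 0. -/

import Mathlib

open Finset Filter Topology Matrix

/-- The (Neumann) discrete Laplacian matrix of the path graph with `n` vertices. -/
noncomputable def pathLap (n : ℕ) : Matrix (Fin n) (Fin n) ℝ :=
  Matrix.of fun i j =>
    if i = j then (if i.val = 0 ∨ i.val = n - 1 then (1 : ℝ) else 2)
    else if i.val + 1 = j.val ∨ j.val + 1 = i.val then -1 else 0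

/-- The diagonal potential matrix: vertex `i` of `Fin (2k+1)` represents the integer `i - k`. -/
noncomputable def potMat (k : ℕ) (α : ℤ → ℝ) : Matrix (Fin (2*k+1)) (Fin (2*k+1)) ℝ :=
  Matrix.diagonal fun i => α ((i : ℤ) - k)

/-- The discrete Schrödinger operator `H_{k,α} = L_k + Σ_j α_j δ_j` on the path `{-k,…,k}`. -/
noncomputable def Hmat (k : ℕ) (α : ℤ → ℝ) : Matrix (Fin (2*k+1)) (Fin (2*k+1)) ℝ :=
  pathLap (2*k+1) + potMat k α

/-- The set of eigenvalues of a real matrix. -/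
def evs {n : ℕ} (M : Matrix (Fin n) (Fin n) ℝ) : Set ℝ :=
  {μ | ∃ f : Fin n → ℝ, f ≠ 0 ∧ M.mulVec f = μ • f}

/-- Lowest eigenvalue. -/
noncomputable def lam0 {n : ℕ} (M : Matrix (Fin n) (Fin n) ℝ) : ℝ := sInf (evs M)

/-- Second-lowest eigenvalue (lowest eigenvalue above the ground state energy). -/
noncomputable def lam1 {n : ℕ} (M : Matrix (Fin n) (Fin n) ℝ) : ℝ :=
  sInf (evs M \ {lam0 M})

/-- Spectral gap. -/
noncomputable def gap {n : ℕ} (M : Matrix (Fin n) (Fin n) ℝ) : ℝ := lam1 M - lam0 M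

/-- `λ_0(V_m, ∞δ_0) = 2 - 2cos(π/(2m+1))`, the Dirichlet ground state energy. -/
noncomputable def dirEVZ (m : ℤ) : ℝ := 2 - 2 * Real.cos (Real.pi / (2 * m + 1))

/-- Index of the integer vertex `j ∈ {-k,…,k}` inside `Fin (2k+1)`. -/
def idx (k : ℕ) (j : ℤ) : Fin (2*k+1) := ⟨(j + k).toNat % (2*k+1), Nat.mod_lt _ (by omega)⟩

/-- `φ` is the normalized strictly positive ground state of `H_{k,α}`. -/
noncomputable def isGS (k : ℕ) (α : ℤ → ℝ) (φ : Fin (2*k+1) → ℝ) : Prop :=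
  (Hmat k α).mulVec φ = lam0 (Hmat k α) • φ ∧ (∑ i, φ i ^ 2 = 1) ∧ ∀ i, 0 < φ i

/-- The single-site potential `α δ_0`. -/
noncomputable def single0 (α : ℝ) : ℤ → ℝ := fun j => if j = 0 then α else 0

/-- The eigenvalue set of the path Laplacian with a Dirichlet condition at the vertex `0`,
i.e. of the compression of `L_k` to functions vanishing at the central vertex. -/
def dirEvsAt0 (k : ℕ) : Set ℝ :=
  {μ | ∃ f : Fin (2*k+1) → ℝ, f ≠ 0 ∧ f (idx k 0) = 0 ∧
    ∀ v, v ≠ idx k 0 → (pathLap (2*k+1)).mulVec f v = μ * f v}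

section GroundState

variable {n : ℕ} {M : Matrix (Fin n) (Fin n) ℝ} {c : Fin n} {g : Fin n → ℝ} {μ : ℝ}

theorem evs_finite (M : Matrix (Fin n) (Fin n) ℝ) : (evs M).Finite := by
  refine (Module.End.finite_hasEigenvalue (Matrix.toLin' M)).subset ?_
  rintro ν ⟨f, hf, h⟩
  exact Module.End.hasEigenvalue_of_hasEigenvector
    (Module.End.hasEigenvector_iff.2 ⟨Module.End.mem_eigenspace_iff.2 (by simpa using h), hf⟩)

/-- The ground state substitution `f = g * h`, for a matrix with nonpositive off-diagonal entries
and a function `g` that is an eigenfunction away from its only zero `c`. -/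
theorem mul_dotProduct_self_le (hM : M.IsSymm) (hoff : ∀ i j, i ≠ j → M i j ≤ 0)
    (hgc : g c = 0) (hg : ∀ i, i ≠ c → 0 < g i) (hMg : ∀ i, i ≠ c → (M *ᵥ g) i = μ * g i)
    {f : Fin n → ℝ} (hf : f c = 0) : μ * (f ⬝ᵥ f) ≤ f ⬝ᵥ M *ᵥ f := by
  obtain ⟨h, rfl⟩ : ∃ h : Fin n → ℝ, f = g * h := by
    refine ⟨fun i => f i / g i, funext fun i => ?_⟩
    by_cases hi : i = c
    · subst hi; simp [hf, hgc]
    · simp [mul_div_cancel₀ _ (hg i hi).ne']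
  have hg0 : ∀ i, 0 ≤ g i := fun i => by
    by_cases hi : i = c
    · rw [hi, hgc]
    · exact (hg i hi).le
  have hsum : 0 ≤ ∑ i, ∑ j, -(M i j * g i * g j * (h i - h j) ^ 2) := by
    refine sum_nonneg fun i _ => sum_nonneg fun j _ => ?_
    by_cases hij : i = j
    · simp [hij]
    · have := mul_nonneg (mul_nonneg (neg_nonneg.2 (hoff i j hij)) (mul_nonneg (hg0 i) (hg0 j)))
        (sq_nonneg (h i - h j))
      linarith
  have hdiag : ∑ i, ∑ j, M i j * g i * g j * h i ^ 2 = μ * ((g * h) ⬝ᵥ (g * h)) := by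
    rw [dotProduct, mul_sum]
    refine sum_congr rfl fun i _ => ?_
    have : ∑ j, M i j * g i * g j * h i ^ 2 = g i * h i ^ 2 * (M *ᵥ g) i := by
      rw [mulVec, dotProduct, mul_sum]
      exact sum_congr rfl fun j _ => by ring
    rw [this]
    by_cases hi : i = c
    · simp [hi, hgc]
    · rw [hMg i hi]; simp only [Pi.mul_apply]; ring
  have hdiag' : ∑ i, ∑ j, M i j * g i * g j * h j ^ 2 = μ * ((g * h) ⬝ᵥ (g * h)) := by
    rw [← hdiag, sum_comm]
    refine sum_congr rfl fun i _ => sum_congr rfl fun j _ => ?_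
    rw [hM.apply i j]; ring
  have hcross : ∑ i, ∑ j, M i j * g i * g j * (h i * h j) = (g * h) ⬝ᵥ M *ᵥ (g * h) := by
    simp only [dotProduct, mulVec, mul_sum, Pi.mul_apply]
    exact sum_congr rfl fun i _ => sum_congr rfl fun j _ => by ring
  have hexpand : ∑ i, ∑ j, -(M i j * g i * g j * (h i - h j) ^ 2)
      = 2 * ∑ i, ∑ j, M i j * g i * g j * (h i * h j)
        - ∑ i, ∑ j, M i j * g i * g j * h i ^ 2 - ∑ i, ∑ j, M i j * g i * g j * h j ^ 2 := by
    simp only [mul_sum, ← sum_sub_distrib]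
    exact sum_congr rfl fun i _ => sum_congr rfl fun j _ => by ring
  rw [hexpand, hdiag, hdiag', hcross] at hsum
  linarith

theorem dotProduct_self_pos' {f : Fin n → ℝ} (hf : f ≠ 0) : 0 < f ⬝ᵥ f :=
  lt_of_le_of_ne (sum_nonneg fun i _ => mul_self_nonneg (f i))
    fun h => hf (dotProduct_self_eq_zero.1 h.symm)

theorem exists_mem_evs_lt (hM : M.IsSymm) (hgc : g c = 0)
    (hMg : ∀ i, i ≠ c → (M *ᵥ g) i = μ * g i) (hMgc : (M *ᵥ g) c ≠ 0) :
    ∃ ν ∈ evs M, ν < μ := by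
  by_contra! hle
  have hN : (M - μ • (1 : Matrix (Fin n) (Fin n) ℝ)).IsHermitian := by
    rw [Matrix.IsHermitian, conjTranspose_eq_transpose_of_trivial, transpose_sub, hM.eq,
      transpose_smul, transpose_one]
  have hpos : (M - μ • (1 : Matrix (Fin n) (Fin n) ℝ)).PosSemidef := by
    refine hN.posSemidef_iff_eigenvalues_nonneg.2 fun i => ?_
    have h := hN.mulVec_eigenvectorBasis i
    rw [sub_mulVec, smul_mulVec, one_mulVec] at h
    have := hle (hN.eigenvalues i + μ) ⟨_, fun h0 => hN.eigenvectorBasis.toBasis.ne_zero i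
      (by ext j; simpa using congrFun h0 j), by rw [add_smul, ← h, sub_add_cancel]⟩
    simpa using this
  have hquad : g ⬝ᵥ M *ᵥ g = μ * (g ⬝ᵥ g) := by
    simp only [dotProduct, mul_sum]
    refine sum_congr rfl fun i _ => ?_
    by_cases hi : i = c
    · simp [hi, hgc]
    · rw [hMg i hi]; ring
  have hzero := (hpos.dotProduct_mulVec_zero_iff g).1 (by
    rw [sub_mulVec, smul_mulVec, one_mulVec, dotProduct_sub, dotProduct_smul, star_trivial, hquad,
      smul_eq_mul, sub_self])
  have := congrFun hzero c
  rw [sub_mulVec, smul_mulVec, one_mulVec] at this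
  exact hMgc (by simpa [hgc] using this)

theorem lam1_eq_of_groundState (hM : M.IsSymm) (hoff : ∀ i j, i ≠ j → M i j ≤ 0)
    (hgc : g c = 0) (hg : ∀ i, i ≠ c → 0 < g i) (hMg : ∀ i, i ≠ c → (M *ᵥ g) i = μ * g i)
    (hMgc : (M *ᵥ g) c ≠ 0) (hμ : μ ∈ evs M) : lam1 M = μ := by
  obtain ⟨ν, hν, hνμ⟩ := exists_mem_evs_lt hM hgc hMg hMgc
  have hfin := evs_finite M
  have hlam : lam0 M ∈ evs M := Set.Nonempty.csInf_mem ⟨ν, hν⟩ hfin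
  have hlt : lam0 M < μ := (csInf_le hfin.bddBelow hν).trans_lt hνμ
  refine IsLeast.csInf_eq ⟨⟨hμ, hlt.ne'⟩, ?_⟩
  rintro ρ ⟨⟨f₂, hf₂, h₂⟩, hρ⟩
  obtain ⟨f₁, hf₁, h₁⟩ := hlam
  by_contra! hρμ
  have hbound {f : Fin n → ℝ} (hf : f c = 0) : μ * (f ⬝ᵥ f) ≤ f ⬝ᵥ M *ᵥ f :=
    mul_dotProduct_self_le hM hoff hgc hg hMg hf
  have hp₁ := dotProduct_self_pos' hf₁
  have hp₂ := dotProduct_self_pos' hf₂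
  have hc₁ : f₁ c ≠ 0 := fun h0 => by
    have := hbound h0
    rw [h₁, dotProduct_smul, smul_eq_mul] at this
    nlinarith
  have horth : f₁ ⬝ᵥ f₂ = 0 := by
    have h : f₁ ⬝ᵥ M *ᵥ f₂ = f₂ ⬝ᵥ M *ᵥ f₁ := by
      rw [dotProduct_mulVec, ← mulVec_transpose, hM.eq, dotProduct_comm]
    rw [h₁, h₂, dotProduct_smul, dotProduct_smul, dotProduct_comm f₂ f₁, smul_eq_mul,
      smul_eq_mul] at h
    have : (ρ - lam0 M) * (f₁ ⬝ᵥ f₂) = 0 := by linarith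
    exact (mul_eq_zero.1 this).resolve_left (sub_ne_zero.2 hρ)
  have h := hbound (f := f₂ c • f₁ - f₁ c • f₂) (by simp [mul_comm])
  simp only [mulVec_sub, mulVec_smul, h₁, h₂, sub_dotProduct, dotProduct_sub, smul_dotProduct,
    dotProduct_smul, smul_eq_mul, horth, dotProduct_comm f₂ f₁] at h
  have k₁ : 0 ≤ (μ - lam0 M) * (f₂ c ^ 2 * (f₁ ⬝ᵥ f₁)) :=
    mul_nonneg (by linarith) (by positivity)
  have k₂ : 0 < (μ - ρ) * (f₁ c ^ 2 * (f₂ ⬝ᵥ f₂)) :=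
    mul_pos (by linarith) (by positivity)
  linarith

end GroundState

theorem pathLap_isSymm (n : ℕ) : (pathLap n).IsSymm := by
  refine Matrix.IsSymm.ext fun i j => ?_
  by_cases h : i = j
  · rw [h]
  · simp [pathLap, h, Ne.symm h, or_comm]

theorem pathLap_nonpos {n : ℕ} {i j : Fin n} (h : i ≠ j) : pathLap n i j ≤ 0 := by
  simp only [pathLap, Matrix.of_apply, h, if_false]
  split_ifs <;> norm_num

theorem pathLap_mulVec {n : ℕ} (hn : 2 ≤ n) (F : ℤ → ℝ) (h0 : F (-1) = F 0)
    (h1 : F n = F (n - 1)) (i : Fin n) :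
    (pathLap n *ᵥ fun j => F (j : ℕ)) i
      = 2 * F (i : ℕ) - F ((i : ℕ) - 1) - F ((i : ℕ) + 1) := by
  have hi := i.isLt
  have hentry : ∀ j : Fin n, pathLap n i j * F (j : ℕ)
      = (if (i : ℕ) = j then (if (i : ℕ) = 0 ∨ (i : ℕ) = n - 1 then 1 else 2) * F (i : ℕ) else 0)
        - (if (i : ℕ) + 1 = j then F ((i : ℕ) + 1) else 0)
        - (if (i : ℕ) - 1 = j then (if (i : ℕ) = 0 then 0 else F ((i : ℕ) - 1)) else 0) := by
    intro j
    simp only [pathLap, Matrix.of_apply, Fin.ext_iff]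
    by_cases hij : (i : ℕ) = j
    · rw [← hij]; simp only [if_true]
      by_cases h : (i : ℕ) = 0
      · simp [h]
      · simp [h, show (i : ℕ) - 1 ≠ i by omega]
    · by_cases hij' : (i : ℕ) + 1 = j
      · rw [← hij']; simp [show (i : ℕ) - 1 ≠ i + 1 by omega]
      · by_cases hji : (j : ℕ) + 1 = i
        · rw [← hji]; simp [show (j : ℕ) + 1 + 1 ≠ j by omega]
        · by_cases h : (i : ℕ) = 0
          · rw [if_neg hij, if_neg hij, if_neg hij', if_neg (by tauto), if_pos h]; simp
          · simp [hij, hij', hji, show (i : ℕ) - 1 ≠ j by omega]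
  rw [mulVec, dotProduct, sum_congr rfl fun j _ => hentry j]
  rw [sum_sub_distrib, sum_sub_distrib,
    Fin.sum_univ_eq_sum_range (fun m => if (i : ℕ) = m then _ else (0 : ℝ)) n,
    Fin.sum_univ_eq_sum_range (fun m => if (i : ℕ) + 1 = m then _ else (0 : ℝ)) n,
    Fin.sum_univ_eq_sum_range (fun m => if (i : ℕ) - 1 = m then _ else (0 : ℝ)) n]
  simp only [sum_ite_eq, mem_range, hi, if_true, show (i : ℕ) - 1 < n by omega]
  by_cases h : (i : ℕ) = 0
  · simp [h, show 1 < n by omega, h0]; ring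
  · by_cases h' : (i : ℕ) = n - 1
    · have e : ((i : ℕ) : ℤ) = n - 1 := by omega
      rw [if_pos (Or.inr h'), if_neg (by omega), if_neg h, e]
      rw [show (n : ℤ) - 1 + 1 = n by ring, h1]; ring
    · rw [if_neg (by tauto), if_pos (by omega), if_neg h]; ring

theorem idx_zero_val (k : ℕ) : (idx k 0 : ℕ) = k := by
  simp [idx, Nat.mod_eq_of_lt (show k < 2 * k + 1 by omega)]

theorem potMat_single0_mulVec (k : ℕ) (α : ℝ) {f : Fin (2 * k + 1) → ℝ} (hf : f (idx k 0) = 0) :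
    potMat k (single0 α) *ᵥ f = 0 := by
  ext i
  rw [potMat, mulVec_diagonal, Pi.zero_apply]
  by_cases hi : i = idx k 0
  · rw [hi, hf, mul_zero]
  · have : ((i : ℕ) : ℤ) - k ≠ 0 := fun h =>
      hi (Fin.ext (by rw [idx_zero_val]; omega))
    simp [single0, this]

theorem Hmat_single0_mulVec (k : ℕ) (α : ℝ) {f : Fin (2 * k + 1) → ℝ} (hf : f (idx k 0) = 0) :
    Hmat k (single0 α) *ᵥ f = pathLap (2 * k + 1) *ᵥ f := by
  rw [Hmat, add_mulVec, potMat_single0_mulVec k α hf, add_zero]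

theorem two_mul_sin_sub (x θ : ℝ) :
    2 * Real.sin x - Real.sin (x - θ) - Real.sin (x + θ) = (2 - 2 * Real.cos θ) * Real.sin x := by
  rw [Real.sin_sub, Real.sin_add]; ring

/-- for `H_{k,α} = L_k + α δ_0` with `α ≥ 0`, the second-lowest eigenvalue
`λ_1(V_k, αδ_0)` equals the lowest eigenvalue `λ_0(V_k, ∞δ_0)` of the Laplacian with a
Dirichlet condition at the vertex `0`. -/
theorem stmt5 (k : ℕ) (hk : 1 ≤ k) (α : ℝ) (hα : 0 ≤ α) :
    lam1 (Hmat k (single0 α)) = sInf (dirEvsAt0 k) := by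
  set θ : ℝ := Real.pi / (2 * k + 1) with hθ
  have hk' : (1 : ℝ) ≤ k := by exact_mod_cast hk
  have hθ0 : 0 < θ := by positivity
  have hθπ : (2 * k + 1) * θ = Real.pi := by rw [hθ]; field_simp
  set μ : ℝ := 2 - 2 * Real.cos θ with hμ
  have hend : Real.sin ((k + 1) * θ) = Real.sin (k * θ) := by
    rw [← Real.sin_pi_sub, ← hθπ]; ring_nf
  have hpos : ∀ x : ℝ, 0 < x → x ≤ k → 0 < Real.sin (x * θ) := fun x hx hxk =>
    Real.sin_pos_of_pos_of_lt_pi (by positivity) (by nlinarith)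
  -- the antisymmetric eigenfunction
  set a : Fin (2 * k + 1) → ℝ := fun j => Real.sin ((((j : ℕ) : ℤ) - k : ℤ) * θ) with ha
  have hac : a (idx k 0) = 0 := by simp [ha, idx_zero_val]
  have hLa : pathLap (2 * k + 1) *ᵥ a = μ • a := by
    ext i
    rw [ha, pathLap_mulVec (by omega) (fun z : ℤ => Real.sin ((z - k : ℤ) * θ))]
    · simp only [Pi.smul_apply, smul_eq_mul]
      rw [hμ, ← two_mul_sin_sub]
      push_cast; ring_nf
    · push_cast
      rw [show (-1 - (k : ℝ)) * θ = -((k + 1) * θ) by ring, Real.sin_neg, hend, ← Real.sin_neg]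
      ring_nf
    · push_cast
      rw [show (2 * (k : ℝ) + 1 - k) * θ = (k + 1) * θ by ring, hend]
      ring_nf
  have ha0 : a ≠ 0 := fun h => by
    have := congrFun h (Fin.last (2 * k))
    have hlast := hpos k (by positivity) le_rfl
    simp only [ha, Fin.val_last, Pi.zero_apply] at this
    push_cast at this
    rw [show (2 * (k : ℝ) - k) * θ = k * θ by ring] at this
    exact hlast.ne' this
  -- its absolute value
  set g : Fin (2 * k + 1) → ℝ := fun j => Real.sin (|((j : ℕ) : ℤ) - k| * θ) with hg
  have hgc : g (idx k 0) = 0 := by simp [hg, idx_zero_val]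
  have hLg (i : Fin (2 * k + 1)) : (pathLap (2 * k + 1) *ᵥ g) i
      = 2 * Real.sin (|((i : ℕ) : ℤ) - k| * θ) - Real.sin (|((i : ℕ) : ℤ) - 1 - k| * θ)
        - Real.sin (|((i : ℕ) : ℤ) + 1 - k| * θ) := by
    rw [hg, pathLap_mulVec (by omega) (fun z : ℤ => Real.sin ((|z - k| : ℤ) * θ))]
    · rw [abs_of_neg (by omega), abs_of_nonpos (by omega)]
      push_cast
      rw [← show (k + 1) * θ = -(-1 - (k : ℝ)) * θ by ring, hend]
      ring_nf
    · rw [abs_of_pos (by omega), abs_of_nonneg (by omega)]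
      push_cast
      rw [show (2 * (k : ℝ) + 1 - k) * θ = (k + 1) * θ by ring, hend]
      ring_nf
  have hne : ∀ i : Fin (2 * k + 1), i ≠ idx k 0 → (i : ℕ) ≠ k := fun i hi h =>
    hi (Fin.ext (by rw [idx_zero_val, h]))
  have hgpos : ∀ i, i ≠ idx k 0 → 0 < g i := fun i hi => by
    have h := hne i hi
    have h' := i.isLt
    refine hpos _ ?_ ?_
    · exact_mod_cast abs_pos.2 (show ((i : ℕ) : ℤ) - k ≠ 0 by omega)
    · exact_mod_cast abs_le.2 (show -(k : ℤ) ≤ ((i : ℕ) : ℤ) - k ∧ ((i : ℕ) : ℤ) - k ≤ k by omega)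
  have hLg' : ∀ i, i ≠ idx k 0 → (pathLap (2 * k + 1) *ᵥ g) i = μ * g i := fun i hi => by
    rw [hLg, hg, hμ, ← two_mul_sin_sub]
    rcases lt_or_gt_of_ne (hne i hi) with h | h
    · rw [abs_of_neg (show ((i : ℕ) : ℤ) - k < 0 by omega), abs_of_neg (by omega),
        abs_of_nonpos (by omega)]
      push_cast; ring_nf
    · rw [abs_of_pos (show 0 < ((i : ℕ) : ℤ) - k by omega), abs_of_nonneg (by omega),
        abs_of_pos (by omega)]
      push_cast; ring_nf
  have hLgc : (pathLap (2 * k + 1) *ᵥ g) (idx k 0) ≠ 0 := by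
    rw [hLg, idx_zero_val]
    have := hpos 1 one_pos hk'
    simp only [one_mul] at this
    simp
    linarith
  have hdir : sInf (dirEvsAt0 k) = μ := by
    refine IsLeast.csInf_eq ⟨⟨a, ha0, hac, fun v _ => by rw [hLa]; rfl⟩, ?_⟩
    rintro ν ⟨f, hf, hfc, h⟩
    have hle := mul_dotProduct_self_le (pathLap_isSymm _) (fun i j => pathLap_nonpos) hgc hgpos
      hLg' hfc
    have heq : f ⬝ᵥ pathLap (2 * k + 1) *ᵥ f = ν * (f ⬝ᵥ f) := by
      simp only [dotProduct, mul_sum]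
      refine sum_congr rfl fun i _ => ?_
      by_cases hi : i = idx k 0
      · simp [hi, hfc]
      · rw [h i hi]; ring
    rw [heq] at hle
    exact le_of_mul_le_mul_right hle (dotProduct_self_pos' hf)
  have hH := Hmat_single0_mulVec k α hgc
  rw [hdir]
  refine lam1_eq_of_groundState (c := idx k 0) (g := g) ?_ (fun i j hij => ?_) hgc hgpos
    (by rwa [hH]) (by rwa [hH]) ⟨a, ha0, by rw [Hmat_single0_mulVec k α hac, hLa]⟩
  · exact (pathLap_isSymm _).add (isSymm_diagonal _)
  · simpa [Hmat, potMat, hij] using pathLap_nonpos hij
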